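/- Let w be a permutation, i ≥ 1 and d ≥ 0. Each ζ ∈ X_{i,d}(w) admits a unique factorization ζ = t_{p₁q₁}⋯t_{p_dq_d} satisfying the defining conditions of X_{i,d}(w); that is, if t_{p₁q₁}⋯t_{p_dq_d} = t_{p'₁q'₁}⋯t_{p'_dq'_d} as permutations and both sequences satisfy those conditions, then (p_j,q_j) = (p'_j,q'_j) for all j. The same uniqueness holds for Y_{i,d}(w). -/

import Mathlib

open scoped Classical

noncomputable section

/-- Permutations of the positive integers. -/
abbrev PPerm := Equiv.Perm ℕ+

/-- A permutation fixes all but finitely many points. -/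
def HasFinSupp (w : PPerm) : Prop := {k : ℕ+ | w k ≠ k}.Finite

/-- The transposition `t_{pq}`. -/
def tr (p q : ℕ+) : PPerm := Equiv.swap p q

/-- The set of inversions `I(w)`. -/
def invSet (w : PPerm) : Set (ℕ+ × ℕ+) := {x | x.1 < x.2 ∧ w x.2 < w x.1}

/-- The length `ℓ(w)` (number of inversions). -/
def len (w : PPerm) : ℕ := (invSet w).ncard

/-- `m_{pq}(z) = #{r > q : z(p) < z(r) < z(q)}`. -/
def mCnt (z : PPerm) (p q : ℕ+) : ℕ := {r : ℕ+ | q < r ∧ z p < z r ∧ z r < z q}.ncard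

/-- `m'_{qp}(z) = #{r < p : z(p) < z(r) < z(q)}`. -/
def m'Cnt (z : PPerm) (q p : ℕ+) : ℕ := {r : ℕ+ | r < p ∧ z p < z r ∧ z r < z q}.ncard

/-- The list of transpositions `t_{p₁q₁}, …, t_{p_dq_d}`. -/
def trList (d : ℕ) (p q : Fin d → ℕ+) : List PPerm := List.ofFn fun j => tr (p j) (q j)

/-- `w_{j+1} = w t_{p₁q₁} ⋯ t_{p_jq_j}` (so `wSeq w d p q 0 = w₁ = w`). -/
def wSeq (w : PPerm) (d : ℕ) (p q : Fin d → ℕ+) (j : ℕ) : PPerm :=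
  w * ((trList d p q).take j).prod

/-- The defining conditions on a factorization for membership in `X_{i,d}(w)`. -/
def IsXFact (w : PPerm) (i d : ℕ) (p q : Fin d → ℕ+) : Prop :=
  (∀ j, (p j : ℕ) ≤ i ∧ i < (q j : ℕ)) ∧
  (∀ j : Fin d, len (wSeq w d p q (j + 1)) = len (wSeq w d p q j) + 1) ∧
  (∀ j k : Fin d, j < k → wSeq w d p q j (p j) < wSeq w d p q k (p k))

/-- The defining conditions on a factorization for membership in `Y_{i,d}(w)`. -/
def IsYFact (w : PPerm) (i d : ℕ) (p q : Fin d → ℕ+) : Prop :=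
  (∀ j, (p j : ℕ) ≤ i ∧ i < (q j : ℕ)) ∧
  (∀ j : Fin d, len (wSeq w d p q (j + 1)) = len (wSeq w d p q j) + 1) ∧
  (∀ j k : Fin d, j < k → wSeq w d p q k (q k) < wSeq w d p q j (q j))

/-- The set `X_{i,d}(w)`. -/
def XSet (w : PPerm) (i d : ℕ) : Set PPerm :=
  {ζ | ∃ p q : Fin d → ℕ+, ζ = (trList d p q).prod ∧ IsXFact w i d p q}

/-- The set `Y_{i,d}(w)`. -/
def YSet (w : PPerm) (i d : ℕ) : Set PPerm :=
  {ζ | ∃ p q : Fin d → ℕ+, ζ = (trList d p q).prod ∧ IsYFact w i d p q}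

/-- `w ∈ S^{(n)}`, i.e. `w(n+1) < w(n+2) < ⋯`. -/
def InSn (n : ℕ) (w : PPerm) : Prop := ∀ k l : ℕ+, (n : ℕ) < (k : ℕ) → k < l → w k < w l

/-- `x₁^{m-1} x₂^{m-2} ⋯ x_{m-1}`, the Schubert polynomial of the longest element of `S_m`. -/
def schubBase (m : ℕ) : MvPolynomial ℕ+ ℤ :=
  ∏ k ∈ Finset.range m, MvPolynomial.X (k.succPNat) ^ (m - 1 - k)

/-- The defining property of the family of Schubert polynomials `w ↦ 𝔖_w`:
the value on dominant "staircase" permutations, together with the divided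
difference recursion `𝔖_{w s_i} = ∂_i 𝔖_w` whenever `ℓ(w s_i) < ℓ(w)`, stated
in the product form `(x_i - x_{i+1}) · 𝔖_{w s_i} = 𝔖_w - s_i 𝔖_w`. -/
def IsSchubertFamily (S : PPerm → MvPolynomial ℕ+ ℤ) : Prop :=
  (∀ m : ℕ, ∀ w : PPerm, (∀ k : ℕ+, (k : ℕ) ≤ m → (w k : ℕ) = m + 1 - (k : ℕ)) →
      (∀ k : ℕ+, m < (k : ℕ) → w k = k) → S w = schubBase m) ∧
  (∀ w : PPerm, ∀ i : ℕ+, len (w * tr i (i + 1)) < len w →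
      (MvPolynomial.X i - MvPolynomial.X (i + 1)) * S (w * tr i (i + 1)) =
        S w - MvPolynomial.rename (Equiv.swap i (i + 1)) (S w))

/-- The complete homogeneous symmetric polynomial `h_d(x₁, …, x_i)`. -/
def hPoly (i d : ℕ) : MvPolynomial ℕ+ ℤ :=
  ∑ m : Sym (Fin i) d, ((m : Multiset (Fin i)).map fun k => MvPolynomial.X (k.val.succPNat)).prod

/-- The elementary symmetric polynomial `e_d(x₁, …, x_i)`. -/
def ePoly (i d : ℕ) : MvPolynomial ℕ+ ℤ :=
  ∑ s ∈ Finset.powersetCard d (Finset.univ : Finset (Fin i)),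
    ∏ k ∈ s, MvPolynomial.X (k.val.succPNat)

/-- Lexicographic order on permutations. -/
def lexLT (u v : PPerm) : Prop := ∃ k : ℕ+, (∀ l, l < k → u l = v l) ∧ u k < v k

/-- Reverse lexicographic order on permutations. -/
def rlexLT (u v : PPerm) : Prop := ∃ k : ℕ+, (∀ l, k < l → u l = v l) ∧ u k < v k

lemma invSet_finite {w : PPerm} (hw : HasFinSupp w) : (invSet w).Finite := by
  obtain ⟨N, hN⟩ := hw.bddAbove
  have fix : ∀ k, N < k → w k = k := fun k hk => by
    by_contra h
    exact absurd (hN h) (not_le.mpr hk)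
  refine ((Set.finite_Iic N).prod (Set.finite_Iic N)).subset ?_
  rintro ⟨a, b⟩ ⟨hab, hlt⟩
  simp only at hab hlt
  have hb : b ≤ N := by
    by_contra! hb
    rw [fix b hb] at hlt
    have haa : w a = a := w.injective (fix (w a) (hb.trans hlt))
    exact absurd hab (not_lt.mpr (haa ▸ hlt).le)
  exact ⟨hab.le.trans hb, hb⟩

lemma HasFinSupp.mul_tr {w : PPerm} (hw : HasFinSupp w) (p q : ℕ+) :
    HasFinSupp (w * tr p q) := by
  refine (hw.union (Set.toFinite {p, q})).subset fun k hk => ?_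
  by_contra hn
  simp only [Set.mem_union, Set.mem_insert_iff, Set.mem_singleton_iff, not_or] at hn
  refine hk ?_
  rw [Equiv.Perm.mul_apply, tr, Equiv.swap_apply_of_ne_of_ne hn.2.1 hn.2.2]
  simpa using hn.1

lemma len_mul_tr_le {w : PPerm} (hw : HasFinSupp w) {p q : ℕ+} (hpq : p < q)
    (hlt : w q < w p) : len (w * tr p q) ≤ len w := by
  refine Set.ncard_le_ncard_of_injOn
    (fun x => if tr p q x.1 < tr p q x.2 then (tr p q x.1, tr p q x.2) else x)
    ?_ ?_ (invSet_finite hw)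
  · rintro ⟨a, b⟩ ⟨hab, hinv⟩
    simp only [Equiv.Perm.mul_apply] at hab hinv
    by_cases h : tr p q a < tr p q b
    · simp only [if_pos h]
      exact ⟨h, hinv⟩
    · simp only [if_neg h]
      refine ⟨hab, ?_⟩
      simp only [tr, Equiv.swap_apply_def] at h hinv ⊢
      split_ifs at h hinv <;> subst_vars <;> order
  · rintro ⟨a, b⟩ ⟨hab, -⟩ ⟨c, e⟩ ⟨hce, -⟩ h
    have invol : ∀ x, tr p q (tr p q x) = x := Equiv.swap_apply_self p q
    simp only at h hab hce
    split_ifs at h with h₁ h₂ h₂ <;> simp only [Prod.mk.injEq] at h ⊢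
    · exact ⟨(tr p q).injective h.1, (tr p q).injective h.2⟩
    · refine absurd ?_ h₂
      rwa [← h.1, ← h.2, invol, invol]
    · refine absurd ?_ h₁
      rwa [h.1, h.2, invol, invol]
    · exact h

lemma lt_of_len_mul_tr {w : PPerm} (hw : HasFinSupp w) {p q : ℕ+} (hpq : p < q)
    (hlen : len (w * tr p q) = len w + 1) : w p < w q := by
  by_contra! h
  have := len_mul_tr_le hw hpq (h.lt_of_ne (w.injective.ne hpq.ne'))
  omega

lemma trList_succ (d : ℕ) (p q : Fin (d + 1) → ℕ+) :
    trList (d + 1) p q = tr (p 0) (q 0) :: trList d (Fin.tail p) (Fin.tail q) := by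
  simp [trList, List.ofFn_succ, Fin.tail]

lemma trList_comm (d : ℕ) (p q : Fin d → ℕ+) : trList d q p = trList d p q := by
  simp [trList, tr, Equiv.swap_comm]

lemma wSeq_zero (w : PPerm) (d : ℕ) (p q : Fin d → ℕ+) : wSeq w d p q 0 = w := by
  simp [wSeq]

lemma wSeq_succ (w : PPerm) (d : ℕ) (p q : Fin (d + 1) → ℕ+) (j : ℕ) :
    wSeq w (d + 1) p q (j + 1) =
      wSeq (w * tr (p 0) (q 0)) d (Fin.tail p) (Fin.tail q) j := by
  simp [wSeq, trList_succ, mul_assoc]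

lemma wSeq_comm (w : PPerm) (d : ℕ) (p q : Fin d → ℕ+) (j : ℕ) :
    wSeq w d q p j = wSeq w d p q j := by
  rw [wSeq, trList_comm, wSeq]

lemma wSeq_step (w : PPerm) (d : ℕ) (p q : Fin d → ℕ+) (j : Fin d) :
    wSeq w d p q (j + 1) = wSeq w d p q j * tr (p j) (q j) := by
  have hj : (j : ℕ) < (trList d p q).length := by simp [trList]
  rw [wSeq, List.prod_take_succ _ _ hj, wSeq, mul_assoc]
  simp [trList]

lemma HasFinSupp.wSeq {w : PPerm} (hw : HasFinSupp w) (d : ℕ) (p q : Fin d → ℕ+) (j : Fin d) :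
    HasFinSupp (wSeq w d p q j) := by
  obtain ⟨j, hj⟩ := j
  induction j with
  | zero => rwa [wSeq_zero]
  | succ j ih =>
    have hj' : j < d := by omega
    have := (ih hj').mul_tr (p ⟨j, hj'⟩) (q ⟨j, hj'⟩)
    rwa [← wSeq_step w d p q ⟨j, hj'⟩] at this

/-- A sequence of transpositions each of which exchanges a value with an `R`-later one, where the
`R`-earlier values occur in `R`-increasing order. -/
def IsMonotoneChain (R : ℕ+ → ℕ+ → Prop) (w : PPerm) (d : ℕ) (p q : Fin d → ℕ+) : Prop :=
  (∀ j : Fin d, R (wSeq w d p q j (p j)) (wSeq w d p q j (q j))) ∧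
  (∀ j k : Fin d, j < k → R (wSeq w d p q j (p j)) (wSeq w d p q k (p k)))

section MonotoneChain

variable {R : ℕ+ → ℕ+ → Prop} {w : PPerm} {d : ℕ}

lemma IsMonotoneChain.head {p q : Fin (d + 1) → ℕ+} (h : IsMonotoneChain R w (d + 1) p q) :
    R (w (p 0)) (w (q 0)) := by
  simpa [wSeq_zero] using h.1 0

lemma IsMonotoneChain.head_rel {p q : Fin (d + 1) → ℕ+} (h : IsMonotoneChain R w (d + 1) p q)
    (j : Fin d) :
    R (w (p 0))
      (wSeq (w * tr (p 0) (q 0)) d (Fin.tail p) (Fin.tail q) j (Fin.tail p j)) := by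
  simpa [wSeq_zero, wSeq_succ, Fin.tail] using h.2 0 j.succ j.succ_pos

lemma IsMonotoneChain.tail {p q : Fin (d + 1) → ℕ+} (h : IsMonotoneChain R w (d + 1) p q) :
    IsMonotoneChain R (w * tr (p 0) (q 0)) d (Fin.tail p) (Fin.tail q) := by
  constructor
  · intro j
    simpa [wSeq_succ, Fin.tail] using h.1 j.succ
  · intro j k hjk
    simpa [wSeq_succ, Fin.tail] using h.2 j.succ k.succ (Fin.succ_lt_succ_iff.mpr hjk)

variable [IsStrictTotalOrder ℕ+ R]

/-- A value that is `R`-before all the moved values keeps its position. -/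
lemma IsMonotoneChain.prod_apply_of_rel {p q : Fin d → ℕ+} (h : IsMonotoneChain R w d p q)
    {x : ℕ+} (hx : ∀ j : Fin d, R (w x) (wSeq w d p q j (p j))) :
    (trList d p q).prod x = x := by
  induction d generalizing w with
  | zero => simp [trList]
  | succ d ih =>
    have hp : R (w x) (w (p 0)) := by simpa [wSeq_zero] using hx 0
    have hxp : x ≠ p 0 := fun e => irrefl_of R (w x) (by rwa [← e] at hp)
    have hxq : x ≠ q 0 := fun e => irrefl_of R (w x) (by
      have := trans_of R hp h.head
      rwa [← e] at this)
    have hfix : tr (p 0) (q 0) x = x := Equiv.swap_apply_of_ne_of_ne hxp hxq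
    rw [trList_succ, List.prod_cons, Equiv.Perm.mul_apply, ih h.tail, hfix]
    intro j
    rw [Equiv.Perm.mul_apply, hfix, ← wSeq_succ]
    exact hx j.succ

lemma IsMonotoneChain.prod_apply_head {p q : Fin (d + 1) → ℕ+}
    (h : IsMonotoneChain R w (d + 1) p q) : (trList (d + 1) p q).prod (q 0) = p 0 := by
  rw [trList_succ, List.prod_cons, Equiv.Perm.mul_apply, h.tail.prod_apply_of_rel]
  · exact Equiv.swap_apply_right _ _
  · intro j
    rw [Equiv.Perm.mul_apply, tr, Equiv.swap_apply_right]
    exact h.head_rel j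

lemma IsMonotoneChain.not_head_rel_head {p q p' q' : Fin (d + 1) → ℕ+}
    (h : IsMonotoneChain R w (d + 1) p q) (h' : IsMonotoneChain R w (d + 1) p' q')
    (heq : (trList (d + 1) p q).prod = (trList (d + 1) p' q').prod) :
    ¬ R (w (p 0)) (w (p' 0)) := by
  intro hlt
  have hfix : (trList (d + 1) p' q').prod (p 0) = p 0 := by
    refine h'.prod_apply_of_rel (Fin.cases ?_ fun j => ?_)
    · simpa [wSeq_zero] using hlt
    · rw [Fin.val_succ, wSeq_succ]
      exact trans_of R hlt (h'.head_rel j)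
  have hpq : p 0 = q 0 :=
    (trList (d + 1) p q).prod.injective (by rw [h.prod_apply_head, heq, hfix])
  exact irrefl_of R (w (p 0)) (by simpa [← hpq] using h.head)

theorem IsMonotoneChain.unique {p q p' q' : Fin d → ℕ+} (h : IsMonotoneChain R w d p q)
    (h' : IsMonotoneChain R w d p' q') (heq : (trList d p q).prod = (trList d p' q').prod) :
    p = p' ∧ q = q' := by
  induction d generalizing w with
  | zero => exact ⟨Subsingleton.elim _ _, Subsingleton.elim _ _⟩
  | succ d ih =>
    have hp : p 0 = p' 0 := by
      rcases trichotomous_of R (w (p 0)) (w (p' 0)) with hlt | he | hgt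
      · exact absurd hlt (h.not_head_rel_head h' heq)
      · exact w.injective he
      · exact absurd hgt (h'.not_head_rel_head h heq.symm)
    have hq : q 0 = q' 0 :=
      (trList (d + 1) p q).prod.injective (by
        rw [h.prod_apply_head, heq, h'.prod_apply_head, hp])
    have ht' := h'.tail
    rw [trList_succ, trList_succ, List.prod_cons, List.prod_cons, ← hp, ← hq] at heq
    rw [← hp, ← hq] at ht'
    obtain ⟨htp, htq⟩ := ih h.tail ht' (mul_left_cancel heq)
    rw [← Fin.cons_self_tail p, ← Fin.cons_self_tail q, ← Fin.cons_self_tail p',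
      ← Fin.cons_self_tail q', hp, hq, htp, htq]
    exact ⟨rfl, rfl⟩

end MonotoneChain

lemma wSeq_apply_lt {w : PPerm} (hw : HasFinSupp w) {i d : ℕ} {p q : Fin d → ℕ+}
    (hpq : ∀ j, (p j : ℕ) ≤ i ∧ i < (q j : ℕ))
    (hlen : ∀ j : Fin d, len (wSeq w d p q (j + 1)) = len (wSeq w d p q j) + 1) (j : Fin d) :
    wSeq w d p q j (p j) < wSeq w d p q j (q j) := by
  refine lt_of_len_mul_tr (hw.wSeq d p q j) ?_ (by rw [← wSeq_step, hlen])
  exact_mod_cast (hpq j).1.trans_lt (hpq j).2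

lemma IsXFact.isMonotoneChain {w : PPerm} (hw : HasFinSupp w) {i d : ℕ} {p q : Fin d → ℕ+}
    (h : IsXFact w i d p q) : IsMonotoneChain (· < ·) w d p q :=
  ⟨wSeq_apply_lt hw h.1 h.2.1, h.2.2⟩

lemma IsYFact.isMonotoneChain {w : PPerm} (hw : HasFinSupp w) {i d : ℕ} {p q : Fin d → ℕ+}
    (h : IsYFact w i d p q) : IsMonotoneChain (· > ·) w d q p := by
  simp only [IsMonotoneChain, wSeq_comm w d p q]
  exact ⟨wSeq_apply_lt hw h.1 h.2.1, h.2.2⟩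

/-- Uniqueness of the factorization of an element of `X_{i,d}(w)` (resp. `Y_{i,d}(w)`)
satisfying the defining conditions. -/
theorem factorization_unique (w : PPerm) (hwf : HasFinSupp w) (i d : ℕ) (hi : 1 ≤ i) :
    (∀ p q p' q' : Fin d → ℕ+, IsXFact w i d p q → IsXFact w i d p' q' →
      (trList d p q).prod = (trList d p' q').prod → p = p' ∧ q = q') ∧
    (∀ p q p' q' : Fin d → ℕ+, IsYFact w i d p q → IsYFact w i d p' q' →
      (trList d p q).prod = (trList d p' q').prod → p = p' ∧ q = q') := by
  refine ⟨fun p q p' q' h h' heq => ?_, fun p q p' q' h h' heq => ?_⟩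
  · exact (h.isMonotoneChain hwf).unique (h'.isMonotoneChain hwf) heq
  · rw [← trList_comm d p q, ← trList_comm d p' q'] at heq
    exact ((h.isMonotoneChain hwf).unique (h'.isMonotoneChain hwf) heq).symm

end
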